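/- For every x ∈ ℝ³ with x ≠ 0 and every t > 0, the three-dimensional Green function with α = β = 1/2 satisfies (√t / π) ∫_0^∞ e^{-|x|²/(4τ)} / (√τ (t + τ) (4πτ)^{3/2}) dτ = 1 / (2 π^{5/2} √t |x|²) − (1 / (8 π^{5/2} t^{3/2})) · e^{|x|²/(4t)} · ∫_{|x|²/(4t)}^∞ (e^{-ξ} / ξ) dξ. -/

import Mathlib

open Real MeasureTheory

lemma rpow_three_halves {y : ℝ} (hy : 0 < y) : y ^ (3 / 2 : ℝ) = y * √y := by
  rw [show (3 / 2 : ℝ) = 1 + 1 / 2 by norm_num, rpow_add hy, rpow_one, ← sqrt_eq_rpow]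

lemma rpow_five_halves {y : ℝ} (hy : 0 < y) : y ^ (5 / 2 : ℝ) = y ^ 2 * √y := by
  rw [show (5 / 2 : ℝ) = 2 + 1 / 2 by norm_num, rpow_add hy, rpow_two, ← sqrt_eq_rpow]

lemma integrableOn_exp_neg_div_Ioi {b : ℝ} (hb : 0 < b) :
    IntegrableOn (fun ξ : ℝ => exp (-ξ) / ξ) (Set.Ioi b) := by
  refine Integrable.mono' ((integrableOn_exp_neg_Ioi b).div_const b)
    (by fun_prop : Measurable fun ξ : ℝ => exp (-ξ) / ξ).aestronglyMeasurable ?_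
  filter_upwards [ae_restrict_mem measurableSet_Ioi] with ξ hξ
  have hξ : b < ξ := hξ
  have hξ0 : 0 < ξ := hb.trans hξ
  rw [norm_of_nonneg (by positivity)]
  gcongr

lemma image_div_sub_Ioi {a : ℝ} (ha : 0 < a) (b : ℝ) :
    (fun ξ : ℝ => a / (ξ - b)) '' Set.Ioi b = Set.Ioi 0 := by
  ext τ
  constructor
  · rintro ⟨ξ, hξ, rfl⟩
    exact div_pos ha (sub_pos.2 hξ)
  · intro hτ
    have hτ : 0 < τ := hτ
    refine ⟨b + a / τ, ?_, ?_⟩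
    · have : 0 < a / τ := by positivity
      simpa using this
    · simp [ha.ne']

lemma integral_exp_neg_div_div_sq_mul_add {a t : ℝ} (ha : 0 < a) (ht : 0 < t) :
    ∫ τ in Set.Ioi (0 : ℝ), exp (-a / τ) / (τ ^ 2 * (t + τ)) =
      1 / (a * t) - exp (a / t) / t ^ 2 * ∫ ξ in Set.Ioi (a / t), exp (-ξ) / ξ := by
  set b := a / t with hb
  have hb0 : 0 < b := by positivity
  have hab : a = b * t := by rw [hb]; field_simp
  have hderiv : ∀ ξ ∈ Set.Ioi b, HasDerivWithinAt (fun ξ : ℝ => a / (ξ - b))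
      (-(a / (ξ - b) ^ 2)) (Set.Ioi b) ξ := by
    intro ξ hξ
    have hne : ξ - b ≠ 0 := (sub_pos.2 hξ).ne'
    have := ((hasDerivAt_const ξ a).div ((hasDerivAt_id ξ).sub_const b) hne).hasDerivWithinAt
      (s := Set.Ioi b)
    refine this.congr_deriv ?_
    simp [neg_div]
  have hinj : Set.InjOn (fun ξ : ℝ => a / (ξ - b)) (Set.Ioi b) := by
    intro ξ hξ η hη h
    have h1 : ξ - b ≠ 0 := (sub_pos.2 hξ).ne'
    have h2 : η - b ≠ 0 := (sub_pos.2 hη).ne'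
    have h : a / (ξ - b) = a / (η - b) := h
    rw [div_eq_div_iff h1 h2] at h
    linarith [mul_left_cancel₀ ha.ne' h]
  rw [← image_div_sub_Ioi ha b,
    integral_image_eq_integral_abs_deriv_smul measurableSet_Ioi hderiv hinj]
  have hcongr : ∀ ξ ∈ Set.Ioi b, |-(a / (ξ - b) ^ 2)| •
      (exp (-a / (a / (ξ - b))) / ((a / (ξ - b)) ^ 2 * (t + a / (ξ - b)))) =
      exp b / (a * t) * (exp (-ξ) - b * (exp (-ξ) / ξ)) := by
    intro ξ hξ
    have h1 : 0 < ξ - b := sub_pos.2 hξ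
    have h2 : 0 < ξ := by linarith
    have h3 : t + a / (ξ - b) = t * ξ / (ξ - b) := by
      rw [hab]; field_simp; ring
    have h4 : -a / (a / (ξ - b)) = b + -ξ := by field_simp; ring
    rw [h3, h4, abs_neg, abs_of_pos (by positivity), smul_eq_mul, exp_add]
    field_simp
  rw [setIntegral_congr_fun measurableSet_Ioi hcongr, integral_const_mul,
    integral_sub (integrableOn_exp_neg_Ioi b) ((integrableOn_exp_neg_div_Ioi hb0).const_mul b),
    integral_const_mul, integral_exp_neg_Ioi, mul_sub]
  congr 1
  · rw [div_mul_eq_mul_div, ← exp_add, add_neg_cancel, exp_zero]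
  · rw [hab]; field_simp

/-- For every `x ∈ ℝ³` nonzero and `t > 0`, the three-dimensional Green function with
`α = β = 1/2` is expressed via the exponential integral. -/
theorem green_half_3d (x : EuclideanSpace ℝ (Fin 3)) (hx : x ≠ 0) (t : ℝ) (ht : 0 < t) :
    (Real.sqrt t / Real.pi) *
      ∫ τ in Set.Ioi (0 : ℝ),
        Real.exp (-‖x‖ ^ 2 / (4 * τ)) /
          (Real.sqrt τ * (t + τ) * (4 * Real.pi * τ) ^ (3 / 2 : ℝ))
      = 1 / (2 * Real.pi ^ (5 / 2 : ℝ) * Real.sqrt t * ‖x‖ ^ 2)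
        - (1 / (8 * Real.pi ^ (5 / 2 : ℝ) * t ^ (3 / 2 : ℝ))) *
            Real.exp (‖x‖ ^ 2 / (4 * t)) *
            ∫ ξ in Set.Ioi (‖x‖ ^ 2 / (4 * t)), Real.exp (-ξ) / ξ := by
  have hr : 0 < ‖x‖ := norm_pos_iff.2 hx
  have hcongr : ∀ τ ∈ Set.Ioi (0 : ℝ), exp (-‖x‖ ^ 2 / (4 * τ)) /
      (√τ * (t + τ) * (4 * π * τ) ^ (3 / 2 : ℝ)) =
      1 / (8 * (π * √π)) * (exp (-(‖x‖ ^ 2 / 4) / τ) / (τ ^ 2 * (t + τ))) := by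
    intro τ hτ
    have hτ : 0 < τ := hτ
    have hsqrt : √(4 * π * τ) = 2 * √π * √τ := by
      rw [sqrt_mul (by positivity), sqrt_mul (by norm_num), show (4 : ℝ) = 2 ^ 2 by norm_num,
        sqrt_sq (by norm_num)]
    have hden : √τ * (t + τ) * (4 * π * τ * (2 * √π * √τ)) =
        8 * (π * √π) * (τ ^ 2 * (t + τ)) := by
      linear_combination 8 * (t + τ) * π * τ * √π * mul_self_sqrt hτ.le
    have hexp : -‖x‖ ^ 2 / (4 * τ) = -(‖x‖ ^ 2 / 4) / τ := by field_simp
    rw [rpow_three_halves (by positivity), hsqrt, hden, hexp]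
    field_simp
  rw [setIntegral_congr_fun measurableSet_Ioi hcongr, integral_const_mul,
    integral_exp_neg_div_div_sq_mul_add (by positivity) ht, rpow_three_halves ht,
    rpow_five_halves pi_pos, div_div]
  have hs : √t ^ 2 = t := sq_sqrt ht.le
  have hs0 : 0 < √t := sqrt_pos.2 ht
  generalize ∫ ξ in Set.Ioi (‖x‖ ^ 2 / (4 * t)), exp (-ξ) / ξ = E
  generalize exp (‖x‖ ^ 2 / (4 * t)) = e
  generalize √t = s at *
  subst hs
  field_simp
  ring
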